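/- For every odd integer k ≥ 1, every integer m > k, and every real number q with 0 < q < 1, the Condorcet least-reversal rule satisfies the (q,k,m)-majority criterion if and only if q ≥ (5k²−2k+1)/(8k²). -/

import Mathlib

open Finset
open scoped Classical

noncomputable section

/-- A preference profile: each of the `n` voters has a ranking of the `m`
candidates, given as a bijection sending each candidate to its rank
(rank `0` is the best).  Voter `i` prefers `a` to `b` iff `P i a < P i b`. -/
abbrev Profile (m n : ℕ) := Fin n → (Fin m ≃ Fin m)

namespace Voting

variable {m n : ℕ}

/-- `h(a,b)`: the number of voters who prefer candidate `a` to candidate `b`. -/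
def pairs (P : Profile m n) (a b : Fin m) : ℕ :=
  (Finset.univ.filter fun i => P i a < P i b).card

/-- `n_1(a)`: the number of voters who rank candidate `a` first. -/
def firstCount (P : Profile m n) (a : Fin m) : ℕ :=
  (Finset.univ.filter fun i => ∀ b, b ≠ a → P i a < P i b).card

/-- `n_m(a)`: the number of voters who rank candidate `a` last. -/
def lastCount (P : Profile m n) (a : Fin m) : ℕ :=
  (Finset.univ.filter fun i => ∀ b, b ≠ a → P i b < P i a).card

/-- The number of voters who give the set `B` the top `|B|` positions. -/
def topSupporters (P : Profile m n) (B : Finset (Fin m)) : ℕ :=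
  (Finset.univ.filter fun i => ∀ a ∈ B, ∀ b ∉ B, P i a < P i b).card

/-- The `(q,k,m)`-majority criterion for a voting rule with `m` candidates:
for every number of voters `n ≥ 1`, every profile, and every `k`-element set `B`
of candidates such that strictly more than `q·n` voters give `B` the top `k`
positions, every winner belongs to `B`. -/
def MajorityCriterion (m k : ℕ) (q : ℝ)
    (rule : (n : ℕ) → Profile m n → Finset (Fin m)) : Prop :=
  ∀ n : ℕ, 1 ≤ n → ∀ P : Profile m n, ∀ B : Finset (Fin m),
    B.card = k → q * (n : ℝ) < (topSupporters P B : ℝ) → rule n P ⊆ B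

/-- The Condorcet least-reversal score `p(d) = Σ_{c ≠ d} max{n/2 − h(d,c), 0}`. -/
def clrScore (P : Profile m n) (d : Fin m) : ℝ :=
  ∑ c ∈ Finset.univ.erase d, max ((n : ℝ) / 2 - (pairs P d c : ℝ)) 0

/-- The Condorcet least-reversal rule: winners have the lowest score `p`. -/
def clrWinners (P : Profile m n) : Finset (Fin m) :=
  Finset.univ.filter fun d => ∀ c, clrScore P d ≤ clrScore P c

/-- The pairwise support, symmetrised so that the diagonal value is `n / 2`. -/
def support (P : Profile m n) (a b : Fin m) : ℝ :=
  ((n : ℝ) + pairs P a b - pairs P b a) / 2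

lemma pairs_add_pairs (P : Profile m n) {a b : Fin m} (hab : a ≠ b) :
    pairs P a b + pairs P b a = n := by
  unfold pairs
  have h := Finset.card_filter_add_card_filter_not (s := (Finset.univ : Finset (Fin n)))
    (fun i => P i a < P i b)
  rw [Finset.card_univ, Fintype.card_fin] at h
  convert h using 3
  ext i
  have : P i a ≠ P i b := fun e => hab ((P i).injective e)
  simp only [Finset.mem_filter, Finset.mem_univ, true_and]
  omega

lemma pairs_triangle (P : Profile m n) (a b c : Fin m) :
    pairs P a c ≤ pairs P a b + pairs P b c := by
  unfold pairs
  refine (Finset.card_le_card ?_).trans (Finset.card_union_le _ _)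
  intro i
  simp only [Finset.mem_filter, Finset.mem_univ, true_and, Finset.mem_union]
  omega

lemma support_of_ne (P : Profile m n) {a b : Fin m} (hab : a ≠ b) :
    support P a b = pairs P a b := by
  have h : (pairs P a b : ℝ) + pairs P b a = n := by exact_mod_cast pairs_add_pairs P hab
  unfold support
  linarith

lemma support_self (P : Profile m n) (a : Fin m) : support P a a = n / 2 := by
  unfold support
  ring

lemma support_add_support (P : Profile m n) (a b : Fin m) :
    support P a b + support P b a = n := by
  unfold support
  ring

lemma support_nonneg (P : Profile m n) (a b : Fin m) : 0 ≤ support P a b := by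
  by_cases hab : a = b
  · subst hab
    rw [support_self]
    positivity
  · rw [support_of_ne P hab]
    positivity

lemma support_triangle (P : Profile m n) (a b c : Fin m) :
    support P a c ≤ support P a b + support P b c := by
  by_cases hac : a = c
  · subst hac
    rw [support_add_support, support_self]
    have : (0 : ℝ) ≤ n := n.cast_nonneg
    linarith
  by_cases hab : a = b
  · subst hab
    linarith [support_nonneg P a a]
  by_cases hbc : b = c
  · subst hbc
    linarith [support_nonneg P b b]
  rw [support_of_ne P hac, support_of_ne P hab, support_of_ne P hbc]
  exact_mod_cast pairs_triangle P a b c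

lemma clrScore_eq_sum (P : Profile m n) (d : Fin m) :
    clrScore P d = ∑ c, max ((n : ℝ) / 2 - support P d c) 0 := by
  rw [← Finset.add_sum_erase _ _ (Finset.mem_univ d), support_self, sub_self, max_self, zero_add]
  refine Finset.sum_congr rfl fun c hc => ?_
  rw [support_of_ne P (Finset.ne_of_mem_erase hc).symm]

/-- A Borda winner has total pairwise deficit at most `N (k - 1)² / (8 k)`. -/
lemma exists_sum_deficit_le {α : Type*} (B : Finset α) (hB : B.Nonempty) (N : ℝ) (hN : 0 ≤ N)
    (h : α → α → ℝ) (h_add : ∀ a b, h a b + h b a = N)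
    (h_tri : ∀ a b c, h a c ≤ h a b + h b c) :
    ∃ a ∈ B, ∑ c ∈ B, max (N / 2 - h a c) 0 ≤
      N * ((B.card : ℝ) - 1) ^ 2 / (8 * B.card) := by
  obtain ⟨a, haB, hmax⟩ := Finset.exists_max_image B (fun a => ∑ e ∈ B, h a e) hB
  refine ⟨a, haB, ?_⟩
  set S := B.filter (fun c => h a c < N / 2) with hS
  set R := (B.filter (fun c => ¬ h a c < N / 2)).erase a with hR
  have haR : a ∈ B.filter (fun c => ¬ h a c < N / 2) := by
    simp only [Finset.mem_filter, haB, true_and]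
    linarith [h_add a a]
  have split (f : α → ℝ) : ∑ c ∈ B, f c = ∑ c ∈ S, f c + (f a + ∑ c ∈ R, f c) := by
    rw [hS, hR, Finset.add_sum_erase _ _ haR, Finset.sum_filter_add_sum_filter_not]
  have hcard : (B.card : ℝ) = S.card + (1 + R.card) := by
    simpa using split (fun _ => 1)
  set J := ∑ c ∈ S, h c a with hJ
  have hdef : ∑ c ∈ B, max (N / 2 - h a c) 0 = J - S.card * (N / 2) := by
    rw [hJ, ← nsmul_eq_mul, ← Finset.sum_const, ← Finset.sum_sub_distrib, hS, Finset.sum_filter]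
    refine Finset.sum_congr rfl fun c _ => ?_
    have := h_add a c
    split_ifs with hc
    · rw [max_eq_left] <;> linarith
    · rw [max_eq_right]
      linarith
  have hSa : ∑ c ∈ S, h a c = S.card * N - J := by
    rw [hJ, ← nsmul_eq_mul, ← Finset.sum_const, ← Finset.sum_sub_distrib]
    refine Finset.sum_congr rfl fun c _ => ?_
    linarith [h_add a c]
  have hSS : ∑ c ∈ S, ∑ e ∈ S, h c e = S.card * S.card * N / 2 := by
    have h2 : ∑ c ∈ S, ∑ e ∈ S, h c e + ∑ c ∈ S, ∑ e ∈ S, h e c = S.card * S.card * N := by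
      simp only [← Finset.sum_add_distrib, h_add, Finset.sum_const, nsmul_eq_mul]
      ring
    rw [Finset.sum_comm (f := fun c e => h e c)] at h2
    linarith
  have hSR : S.card * ∑ e ∈ R, h a e + R.card * (J - S.card * N) ≤
      ∑ c ∈ S, ∑ e ∈ R, h c e := by
    calc _ = ∑ c ∈ S, ∑ e ∈ R, (h a e + (h c a - N)) := by
          simp only [Finset.sum_add_distrib, Finset.sum_const, nsmul_eq_mul, ← Finset.mul_sum,
            Finset.sum_sub_distrib, hJ]
      _ ≤ _ := Finset.sum_le_sum fun c _ => Finset.sum_le_sum fun e _ => by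
          linarith [h_tri a c e, h_add a c]
  have hborda : ∑ c ∈ S, ∑ e ∈ B, h c e ≤ S.card * ∑ e ∈ B, h a e := by
    rw [← nsmul_eq_mul]
    exact Finset.sum_le_card_nsmul _ _ _ fun c hc => hmax c (Finset.mem_filter.mp hc).1
  have haa : h a a = N / 2 := by linarith [h_add a a]
  simp only [split, Finset.sum_add_distrib] at hborda
  rw [hSS, hSa, haa, ← hJ] at hborda
  rw [hdef, le_div_iff₀ (by rw [hcard]; positivity), hcard]
  nlinarith [mul_nonneg hN (sq_nonneg ((S.card : ℝ) - R.card))]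

lemma topSupporters_le_pairs (P : Profile m n) (B : Finset (Fin m)) {a b : Fin m}
    (ha : a ∈ B) (hb : b ∉ B) : topSupporters P B ≤ pairs P a b := by
  refine Finset.card_le_card fun i hi => ?_
  simp only [Finset.mem_filter, Finset.mem_univ, true_and] at hi ⊢
  exact hi a ha b hb

lemma topSupporters_le_support (P : Profile m n) (B : Finset (Fin m)) {a b : Fin m}
    (ha : a ∈ B) (hb : b ∉ B) : (topSupporters P B : ℝ) ≤ support P a b := by
  rw [support_of_ne P (ne_of_mem_of_not_mem ha hb)]
  exact_mod_cast topSupporters_le_pairs P B ha hb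

lemma majorityCriterion_of_le {k : ℕ} (hk : 1 ≤ k) (q : ℝ)
    (hq : (5 * (k : ℝ) ^ 2 - 2 * (k : ℝ) + 1) / (8 * (k : ℝ) ^ 2) ≤ q) :
    MajorityCriterion m k q (fun _ P => clrWinners P) := by
  intro n hn P B hB ht d hd
  by_contra hdB
  have hn0 : (0 : ℝ) < n := by exact_mod_cast hn
  have hk0 : (0 : ℝ) < k := by exact_mod_cast hk
  obtain ⟨a, haB, ha⟩ := exists_sum_deficit_le B (Finset.card_pos.mp (by omega)) n hn0.le
    (support P) (support_add_support P) (support_triangle P)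
  rw [hB] at ha
  have hda : clrScore P d ≤ clrScore P a := (Finset.mem_filter.mp hd).2 a
  set t : ℝ := (topSupporters P B : ℝ)
  rw [div_le_iff₀ (by positivity)] at hq
  have htk : (5 * (k : ℝ) ^ 2 - 2 * k + 1) * n < t * (8 * k ^ 2) := by
    calc _ ≤ q * (8 * k ^ 2) * n := by gcongr
      _ = q * n * (8 * k ^ 2) := by ring
      _ < _ := by gcongr
  have hthalf : (n : ℝ) / 2 < t := by
    by_contra! hle
    nlinarith [mul_le_mul_of_nonneg_right hle (by positivity : (0 : ℝ) ≤ 8 * (k : ℝ) ^ 2),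
      mul_nonneg hn0.le (sq_nonneg ((k : ℝ) - 1))]
  have hpa : clrScore P a = ∑ c ∈ B, max ((n : ℝ) / 2 - support P a c) 0 := by
    rw [clrScore_eq_sum]
    refine (Finset.sum_subset (Finset.subset_univ B) fun c _ hc => max_eq_right ?_).symm
    linarith [topSupporters_le_support P B haB hc]
  have hpd : k * (t - n / 2) ≤ clrScore P d := by
    rw [clrScore_eq_sum]
    calc (k : ℝ) * (t - n / 2) = ∑ c ∈ B, (t - n / 2) := by
          rw [Finset.sum_const, hB, nsmul_eq_mul]
      _ ≤ ∑ c ∈ B, max ((n : ℝ) / 2 - support P d c) 0 :=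
          Finset.sum_le_sum fun c hc => le_max_of_le_left (by
            linarith [topSupporters_le_support P B hc hdB, support_add_support P d c])
      _ ≤ _ := Finset.sum_le_sum_of_subset_of_nonneg (Finset.subset_univ B)
          fun _ _ _ => le_max_right _ _
  have hle : k * (t - n / 2) ≤ n * ((k : ℝ) - 1) ^ 2 / (8 * k) := by linarith
  rw [le_div_iff₀ (by positivity)] at hle
  nlinarith

/-- The rank of candidate `c` in the cyclic profile with shift `i`: the first `k` candidates are
rotated by `i`; candidate `k` comes after them if `top` holds and before them otherwise; the
remaining candidates keep their places. -/
def cyclicRank (k i : ℕ) (top : Prop) (c : ℕ) : ℕ :=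
  if c < k then (if top then (c + i) % k else (c + i) % k + 1)
  else if c = k then (if top then k else 0) else c

lemma cyclicRank_lt {k : ℕ} (hk : 1 ≤ k) (hkm : k < m) (i : ℕ) (top : Prop) {c : ℕ}
    (hc : c < m) : cyclicRank k i top c < m := by
  have := Nat.mod_lt (c + i) hk
  unfold cyclicRank
  split_ifs <;> omega

lemma cyclicRank_injective {k : ℕ} (hk : 1 ≤ k) (i : ℕ) (top : Prop) :
    Function.Injective (cyclicRank k i top) := by
  intro c d hcd
  have hc := Nat.mod_lt (c + i) hk
  have hd := Nat.mod_lt (d + i) hk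
  have key : c < k → d < k → (c + i) % k = (d + i) % k → c = d := fun h1 h2 h3 =>
    Nat.ModEq.eq_of_lt_of_lt (Nat.ModEq.add_right_cancel' i h3) h1 h2
  unfold cyclicRank at hcd
  split_ifs at hcd <;> omega

/-- The profile of `n` voters, voter `i` having shift `i` and supporting the first `k`
candidates iff `i < t`. -/
def cyclicProfile {k : ℕ} (hk : 1 ≤ k) (hkm : k < m) (n t : ℕ) : Profile m n := fun i =>
  Equiv.ofBijective
    (fun c => ⟨cyclicRank k i (i.val < t) c, cyclicRank_lt hk hkm i _ c.isLt⟩)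
    (Finite.injective_iff_bijective.mp fun _ _ hcd =>
      Fin.ext (cyclicRank_injective hk i _ (congrArg Fin.val hcd)))

lemma cyclicProfile_lt_iff {k : ℕ} (hk : 1 ≤ k) (hkm : k < m) (n t : ℕ) (i : Fin n)
    (a b : Fin m) : cyclicProfile hk hkm n t i a < cyclicProfile hk hkm n t i b ↔
      cyclicRank k i (i.val < t) a < cyclicRank k i (i.val < t) b := Iff.rfl

lemma count_mul_of_periodic {p : ℕ → Prop} {k : ℕ} (hp : Function.Periodic p k)
    (N : ℕ) : Nat.count p (k * N) = N * Nat.count p k := by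
  induction N with
  | zero => simp
  | succ N ih =>
    have : (fun j => p (k * N + j)) = p := by
      funext j
      rw [add_comm, mul_comm]
      exact hp.nat_mul N j
    rw [mul_add, mul_one, Nat.count_add, ih]
    simp only [this]
    ring

lemma card_filter_fin_eq_count (p : ℕ → Prop) (n : ℕ) :
    (Finset.univ.filter fun i : Fin n => p i).card = Nat.count p n := by
  rw [Nat.count_eq_card_filter_range, Finset.card_filter, Finset.card_filter,
    Fin.sum_univ_eq_sum_range (fun i => if p i then 1 else 0)]

lemma count_rotation {k : ℕ} (a j : ℕ) (hj : 1 ≤ j) (hjk : j < k) :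
    Nat.count (fun i => (a + i) % k < ((a + j) % k + i) % k) k ≤ k - j := by
  have hper : Function.Periodic (fun x : ℕ => x % k < (x + j) % k) k := by
    intro x
    simp only [Nat.add_mod_right, add_right_comm x k j]
  have h1 : Nat.count (fun i => (a + i) % k < ((a + j) % k + i) % k) k =
      Nat.count (fun x => x % k < (x + j) % k) k := by
    rw [← Nat.filter_Ico_card_eq_of_periodic a k _ hper, Nat.count_eq_card_filter_range]
    refine Finset.card_bij (fun i _ => a + i) ?_ ?_ ?_
    · intro i hi
      simp only [Finset.mem_filter, Finset.mem_range, Finset.mem_Ico, Nat.mod_add_mod] at hi ⊢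
      refine ⟨by omega, ?_⟩
      rw [add_right_comm]
      exact hi.2
    · intro x _ y _ h
      omega
    · intro x hx
      simp only [Finset.mem_filter, Finset.mem_range, Finset.mem_Ico, Nat.mod_add_mod] at hx ⊢
      refine ⟨x - a, ⟨by omega, ?_⟩, by omega⟩
      rw [add_right_comm, show a + (x - a) = x by omega]
      exact hx.2
  rw [h1, Nat.count_eq_card_filter_range]
  calc _ ≤ (Finset.range (k - j)).card := Finset.card_le_card fun x hx => by
        simp only [Finset.mem_filter, Finset.mem_range] at hx ⊢
        by_contra hge
        have h2 : (x + j) % k = x + j - k := by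
          rw [Nat.mod_eq_sub_mod (by omega), Nat.mod_eq_of_lt (by omega)]
        rw [h2, Nat.mod_eq_of_lt hx.1] at hx
        omega
    _ = _ := Finset.card_range _

lemma pairs_cyclicProfile_le {k : ℕ} (hk : 1 ≤ k) (hkm : k < m) (N t : ℕ) (a c : Fin m)
    (ha : a.val < k) (j : ℕ) (hj : 1 ≤ j) (hjk : j < k) (hc : c.val = (a.val + j) % k) :
    pairs (cyclicProfile hk hkm (k * N) t) a c ≤ N * (k - j) := by
  have hck : c.val < k := hc ▸ Nat.mod_lt _ hk
  have hiff (i : Fin (k * N)) :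
      cyclicProfile hk hkm (k * N) t i a < cyclicProfile hk hkm (k * N) t i c ↔
        (a.val + i) % k < ((a.val + j) % k + i) % k := by
    rw [cyclicProfile_lt_iff, cyclicRank, cyclicRank, if_pos ha, if_pos hck, hc]
    split_ifs <;> omega
  have hper : Function.Periodic (fun i => (a.val + i) % k < ((a.val + j) % k + i) % k) k := by
    intro x
    simp only [← add_assoc, Nat.add_mod_right]
  calc pairs (cyclicProfile hk hkm (k * N) t) a c =
        (Finset.univ.filter fun i : Fin (k * N) =>
          (a.val + i) % k < ((a.val + j) % k + i) % k).card :=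
        congrArg Finset.card (Finset.filter_congr fun i _ => hiff i)
    _ = Nat.count (fun i => (a.val + i) % k < ((a.val + j) % k + i) % k) (k * N) := by
        convert card_filter_fin_eq_count
          (fun i => (a.val + i) % k < ((a.val + j) % k + i) % k) (k * N)
    _ = N * Nat.count (fun i => (a.val + i) % k < ((a.val + j) % k + i) % k) k := by
        convert count_mul_of_periodic hper N
    _ ≤ N * (k - j) := Nat.mul_le_mul_left _ (by convert count_rotation a j hj hjk)

lemma le_clrScore_cyclicProfile (l N t : ℕ) (hkm : 2 * l + 1 < m) (a : Fin m)
    (ha : a.val < 2 * l + 1) : (N : ℝ) * l ^ 2 / 2 ≤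
      clrScore (cyclicProfile (Nat.le_add_left 1 _) hkm ((2 * l + 1) * N) t) a := by
  set k := 2 * l + 1 with hk
  have hk1 : 1 ≤ k := by omega
  let f : ℕ → Fin m := fun i => ⟨(a.val + (l + 1 + i)) % k, (Nat.mod_lt _ hk1).trans hkm⟩
  have hf : Set.InjOn f (Finset.range l) := by
    intro x hx y hy hxy
    have hx' := Finset.mem_range.mp hx
    have hy' := Finset.mem_range.mp hy
    have h1 : a.val + (l + 1 + x) ≡ a.val + (l + 1 + y) [MOD k] := congrArg Fin.val hxy
    have h2 := Nat.ModEq.eq_of_lt_of_lt (Nat.ModEq.add_left_cancel' _ h1) (by omega) (by omega)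
    omega
  have hne (i : ℕ) (hi : i < l) : f i ≠ a := by
    intro h
    have h1 : a.val + (l + 1 + i) ≡ a.val + 0 [MOD k] := by
      have := congrArg Fin.val h
      simp only [f] at this
      rw [Nat.ModEq, this, add_zero, Nat.mod_eq_of_lt ha]
    have h2 := Nat.ModEq.eq_of_lt_of_lt (Nat.ModEq.add_left_cancel' _ h1) (by omega) (by omega)
    omega
  unfold clrScore
  have hsum : ∑ i ∈ Finset.range l, ((2 * (i : ℝ) + 1)) = (l : ℝ) ^ 2 := by
    clear * -
    induction l with
    | zero => simp
    | succ l ih =>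
      rw [Finset.sum_range_succ, ih]
      push_cast
      ring
  calc (N : ℝ) * l ^ 2 / 2 = ∑ i ∈ Finset.range l, (N / 2 * (2 * (i : ℝ) + 1)) := by
        rw [← Finset.mul_sum, hsum]
        ring
    _ ≤ ∑ i ∈ Finset.range l, max (((k * N : ℕ) : ℝ) / 2 -
          pairs (cyclicProfile hk1 hkm (k * N) t) a (f i)) 0 := by
        refine Finset.sum_le_sum fun i hi => le_max_of_le_left ?_
        have hi' := Finset.mem_range.mp hi
        have h := pairs_cyclicProfile_le hk1 hkm N t a (f i) ha (l + 1 + i) (by omega)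
          (by omega) rfl
        have h' : (pairs (cyclicProfile hk1 hkm (k * N) t) a (f i) : ℝ) ≤ N * (l - i) := by
          have hk' : k - (l + 1 + i) = l - i := by omega
          rw [hk'] at h
          rw [← Nat.cast_sub hi'.le]
          exact_mod_cast h
        have hkN : ((k * N : ℕ) : ℝ) = (2 * l + 1) * N := by
          rw [hk]
          push_cast
          rfl
        rw [hkN]
        linarith
    _ = ∑ c ∈ (Finset.range l).image f, max (((k * N : ℕ) : ℝ) / 2 -
          pairs (cyclicProfile hk1 hkm (k * N) t) a c) 0 := by
        rw [Finset.sum_image hf]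
    _ ≤ _ := by
        refine Finset.sum_le_sum_of_subset_of_nonneg ?_ fun _ _ _ => le_max_right _ _
        intro c hc
        obtain ⟨i, hi, rfl⟩ := Finset.mem_image.mp hc
        exact Finset.mem_erase.mpr ⟨hne i (Finset.mem_range.mp hi), Finset.mem_univ _⟩

lemma card_filter_val_lt {n t : ℕ} (ht : t ≤ n) :
    (Finset.univ.filter fun i : Fin n => i.val < t).card = t := by
  rw [Fin.card_filter_val_lt, min_eq_right ht]

lemma clrScore_cyclicProfile_le {k : ℕ} (hk : 1 ≤ k) (hkm : k < m) {n t : ℕ} (ht : t ≤ n)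
    (hnt : n ≤ 2 * t) : clrScore (cyclicProfile hk hkm n t) ⟨k, hkm⟩ ≤ k * (t - (n : ℝ) / 2) := by
  set P := cyclicProfile hk hkm n t
  set d : Fin m := ⟨k, hkm⟩
  have hnt' : (n : ℝ) ≤ 2 * t := by exact_mod_cast hnt
  have hcard : (Finset.univ.filter fun c : Fin m => c.val < k).card = k :=
    card_filter_val_lt hkm.le
  have hdB (c : Fin m) (hc : c.val < k) : pairs P d c = n - t := by
    have h := Finset.card_filter_add_card_filter_not (s := (Finset.univ : Finset (Fin n)))
      (fun i => i.val < t)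
    rw [card_filter_val_lt ht, Finset.card_univ, Fintype.card_fin] at h
    rw [show n - t = (Finset.univ.filter fun i : Fin n => ¬ i.val < t).card by omega]
    unfold pairs
    congr 1
    ext i
    have := Nat.mod_lt (c.val + i) hk
    simp only [Finset.mem_filter, Finset.mem_univ, true_and, P, cyclicProfile_lt_iff, d,
      cyclicRank, lt_irrefl, if_false, if_true, if_pos hc]
    split_ifs <;> omega
  have hdR (c : Fin m) (hc : ¬ c.val < k) (hcd : c ≠ d) : pairs P d c = n := by
    have hck : c.val ≠ k := fun e => hcd (Fin.ext e)
    unfold pairs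
    rw [Finset.filter_true_of_mem, Finset.card_univ, Fintype.card_fin]
    intro i _
    simp only [P, cyclicProfile_lt_iff, d, cyclicRank, lt_irrefl, if_false, if_true, if_neg hc,
      if_neg hck]
    split_ifs <;> omega
  unfold clrScore
  calc _ = ∑ c ∈ Finset.univ.erase d, if c.val < k then t - (n : ℝ) / 2 else 0 := by
        refine Finset.sum_congr rfl fun c hc => ?_
        split_ifs with hck
        · rw [hdB c hck, Nat.cast_sub ht, max_eq_left] <;> linarith
        · rw [hdR c hck (Finset.ne_of_mem_erase hc), max_eq_right]
          linarith [(n.cast_nonneg : (0 : ℝ) ≤ n)]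
    _ ≤ ∑ c : Fin m, if c.val < k then t - (n : ℝ) / 2 else 0 := by
        refine Finset.sum_le_sum_of_subset_of_nonneg (Finset.erase_subset _ _) fun c _ _ => ?_
        split_ifs <;> linarith
    _ = _ := by rw [← Finset.sum_filter, Finset.sum_const, hcard, nsmul_eq_mul]

lemma le_topSupporters_cyclicProfile {k : ℕ} (hk : 1 ≤ k) (hkm : k < m) {n t : ℕ} (ht : t ≤ n) :
    t ≤ topSupporters (cyclicProfile hk hkm n t)
      (Finset.univ.filter fun c : Fin m => c.val < k) := by
  refine (card_filter_val_lt ht).symm.le.trans (Finset.card_le_card fun i hi => ?_)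
  simp only [Finset.mem_filter, Finset.mem_univ, true_and] at hi ⊢
  intro a ha b hb
  have := Nat.mod_lt (a.val + i) hk
  simp only [cyclicProfile_lt_iff, cyclicRank, if_pos ha, if_neg hb, if_pos hi]
  split_ifs <;> omega

lemma not_clrWinners_subset (P : Profile m n) (B : Finset (Fin m)) (d : Fin m) (hd : d ∉ B)
    (h : ∀ a ∈ B, clrScore P d ≤ clrScore P a) : ¬ clrWinners P ⊆ B := by
  intro hsub
  obtain ⟨a, -, ha⟩ := Finset.exists_min_image Finset.univ (clrScore P) ⟨d, Finset.mem_univ d⟩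
  have haB : a ∈ B := hsub (Finset.mem_filter.mpr
    ⟨Finset.mem_univ a, fun c => ha c (Finset.mem_univ c)⟩)
  exact hd (hsub (Finset.mem_filter.mpr
    ⟨Finset.mem_univ d, fun c => (h a haB).trans (ha c (Finset.mem_univ c))⟩))

lemma not_majorityCriterion_of_lt (l : ℕ) (hkm : 2 * l + 1 < m) (q : ℝ)
    (hq : q < (5 * ((2 * l + 1 : ℕ) : ℝ) ^ 2 - 2 * ((2 * l + 1 : ℕ) : ℝ) + 1) /
      (8 * ((2 * l + 1 : ℕ) : ℝ) ^ 2)) :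
    ¬ MajorityCriterion m (2 * l + 1) q (fun _ P => clrWinners P) := by
  intro hmaj
  set N := 8 * (2 * l + 1) with hN
  set n := (2 * l + 1) * N with hn
  set t := 20 * l ^ 2 + 16 * l + 4 with htdef
  have hn' : n = 32 * l ^ 2 + 32 * l + 8 := by
    rw [hn, hN]
    ring
  have ht : t ≤ n := by omega
  have hk : 1 ≤ 2 * l + 1 := by omega
  refine not_clrWinners_subset (cyclicProfile hk hkm n t)
    (Finset.univ.filter fun c : Fin m => c.val < 2 * l + 1) ⟨2 * l + 1, hkm⟩ (by simp) ?_
    (hmaj n (by omega) _ _ (card_filter_val_lt hkm.le) ?_)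
  · intro a ha
    refine (clrScore_cyclicProfile_le hk hkm ht (by omega)).trans (le_trans (le_of_eq ?_)
      (le_clrScore_cyclicProfile l N t hkm a (Finset.mem_filter.mp ha).2))
    rw [hn', htdef, hN]
    push_cast
    ring
  · refine lt_of_lt_of_le ?_ (Nat.cast_le.mpr (le_topSupporters_cyclicProfile hk hkm ht))
    rw [lt_div_iff₀ (by positivity)] at hq
    rw [hn', htdef]
    push_cast at hq ⊢
    linarith

/-- For every odd integer `k ≥ 1`, every `m > k` and every real `q` with
`0 < q < 1`, the Condorcet least-reversal rule satisfies the `(q,k,m)`-majority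
criterion iff `q ≥ (5k²−2k+1)/(8k²)`. -/
theorem clr_qkm_majority_odd (m k : ℕ) (hk : 1 ≤ k) (hko : k % 2 = 1)
    (hmk : k < m) (q : ℝ) (hq0 : 0 < q) (hq1 : q < 1) :
    MajorityCriterion m k q (fun n P => clrWinners P) ↔
      (5 * (k : ℝ) ^ 2 - 2 * (k : ℝ) + 1) / (8 * (k : ℝ) ^ 2) ≤ q := by
  obtain ⟨l, rfl⟩ : ∃ l, k = 2 * l + 1 := ⟨k / 2, by omega⟩
  refine ⟨fun h => ?_, majorityCriterion_of_le hk q⟩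
  by_contra! hlt
  exact not_majorityCriterion_of_lt l hmk q hlt h

end Voting
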